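/- For the Markov chain (N_n) with transition probabilities p started at 1, the expected first return time to state 1 equals the reciprocal of the stationary mass at 1: E[γ] = m^2/(m-1)^2. -/

import Mathlib

open MeasureTheory
open scoped ENNReal Classical

/-- The transition probabilities `p(i,j) = (i+j-1 choose i) * m^(i+1)/(m+1)^(i+j)` of the
local-time Markov chain of the `m`-biased random walk. -/
noncomputable def ptrans (m : ℝ) (i j : ℕ) : ℝ :=
  ((i + j - 1).choose i : ℝ) * m ^ (i + 1) / (m + 1) ^ (i + j)

/-- The first return time to state `1` of a trajectory `ω` (junk value if there is
no return, so it must always be used together with the event `∃ n ≥ 1, ω n = 1`). -/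
noncomputable def retTime (ω : ℕ → ℕ) : ℕ :=
  sInf {n : ℕ | 1 ≤ n ∧ ω n = 1}

/-- `μ` is (the law of) the Markov chain with transition probabilities `p(i,j)`
started at `1`, expressed through its finite-dimensional (cylinder) distributions. -/
def IsLocalTimeChain (m : ℝ) (μ : Measure (ℕ → ℕ)) : Prop :=
  ∀ (n : ℕ) (x : ℕ → ℕ),
    μ {ω | ∀ k ≤ n, ω k = x k} =
      (if x 0 = 1 then 1 else 0) *
        ∏ k ∈ Finset.range n, ENNReal.ofReal (ptrans m (x k) (x (k + 1)))

/-- Decomposition of the measure of a set along the fibres of a measurable countably valued map. -/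
theorem measure_eq_tsum_inter_fiber {Ω β : Type*} [MeasurableSpace Ω] [MeasurableSpace β]
    [Countable β] [MeasurableSingletonClass β] (μ : Measure Ω) {g : Ω → β} (hg : Measurable g)
    {A : Set Ω} (hA : MeasurableSet A) :
    μ A = ∑' b, μ (A ∩ {ω | g ω = b}) := by
  rw [← measure_iUnion]
  · congr 1
    ext ω
    simp
  · intro a b hab
    refine Set.disjoint_left.2 ?_
    rintro ω ⟨-, h1⟩ ⟨-, h2⟩
    exact hab (h1.symm.trans h2)
  · exact fun b => hA.inter (hg (measurableSet_singleton b))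

theorem measurableSet_coord_eq (n i : ℕ) : MeasurableSet {ω : ℕ → ℕ | ω n = i} :=
  measurableSet_eq_fun (measurable_pi_apply n) measurable_const

/-- Extension by zero of a finite history to a full trajectory. -/
def extendHistory (n : ℕ) (x : Fin (n + 1) → ℕ) (k : ℕ) : ℕ :=
  if h : k < n + 1 then x ⟨k, h⟩ else 0

theorem fiber_restrict_eq (n : ℕ) (x : Fin (n + 1) → ℕ) :
    {ω : ℕ → ℕ | (fun k : Fin (n + 1) => ω k) = x} =
      {ω | ∀ k ≤ n, ω k = extendHistory n x k} := by
  ext ω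
  simp only [Set.mem_ofPred_eq, funext_iff, extendHistory]
  constructor
  · intro h k hk
    rw [dif_pos (by omega)]
    exact h ⟨k, by omega⟩
  · intro h k
    have := h k (by omega)
    rwa [dif_pos k.2] at this

/-- The one-step Markov property: conditioning on an event `S` of the past up to time `n`. -/
theorem IsLocalTimeChain.measure_inter_succ {m : ℝ} {μ : Measure (ℕ → ℕ)}
    (hμ : IsLocalTimeChain m μ) {n : ℕ} {S : Set (ℕ → ℕ)} (hS : MeasurableSet S)
    (hdep : ∀ ω ω' : ℕ → ℕ, (∀ k ≤ n, ω k = ω' k) → ω ∈ S → ω' ∈ S) (j : ℕ) :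
    μ (S ∩ {ω | ω (n + 1) = j}) =
      ∑' i, μ (S ∩ {ω | ω n = i}) * ENNReal.ofReal (ptrans m i j) := by
  have hg : Measurable (fun (ω : ℕ → ℕ) (k : Fin (n + 1)) => ω k) := by fun_prop
  rw [measure_eq_tsum_inter_fiber μ hg (hS.inter (measurableSet_coord_eq (n + 1) j))]
  simp_rw [fun i => measure_eq_tsum_inter_fiber μ hg (hS.inter (measurableSet_coord_eq n i)),
    ← ENNReal.tsum_mul_right]
  rw [ENNReal.tsum_comm]
  refine tsum_congr fun x => ?_
  simp_rw [fiber_restrict_eq]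
  set y := extendHistory n x
  rw [tsum_eq_single (y n)]
  · by_cases hy : y ∈ S
    · have h1 : S ∩ {ω | ω (n + 1) = j} ∩ {ω | ∀ k ≤ n, ω k = y k} =
          {ω | ∀ k ≤ n + 1, ω k = Function.update y (n + 1) j k} := by
        ext ω
        simp only [Set.mem_inter_iff, Set.mem_ofPred_eq]
        constructor
        · rintro ⟨⟨-, h⟩, h'⟩ k hk
          rcases Nat.lt_or_ge n k with hk' | hk'
          · obtain rfl : k = n + 1 := by omega
            simpa using h
          · rw [Function.update_of_ne (by omega)]
            exact h' k hk'
        · intro h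
          have h' : ∀ k ≤ n, ω k = y k := fun k hk => by
            rw [h k (by omega), Function.update_of_ne (by omega)]
          exact ⟨⟨hdep y ω (fun k hk => (h' k hk).symm) hy, by simpa using h (n + 1) le_rfl⟩, h'⟩
      have h2 : S ∩ {ω | ω n = y n} ∩ {ω | ∀ k ≤ n, ω k = y k} =
          {ω | ∀ k ≤ n, ω k = y k} := by
        ext ω
        simp only [Set.mem_inter_iff, Set.mem_ofPred_eq, and_iff_right_iff_imp]
        exact fun h => ⟨hdep y ω (fun k hk => (h k hk).symm) hy, h n le_rfl⟩
      rw [h1, h2, hμ, hμ, Finset.prod_range_succ, ← mul_assoc,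
        Function.update_of_ne (by omega), Function.update_of_ne (by omega), Function.update_self]
      congr 2
      refine Finset.prod_congr rfl fun k hk => ?_
      have := Finset.mem_range.1 hk
      rw [Function.update_of_ne (by omega), Function.update_of_ne (by omega)]
    · have h0 : ∀ T : Set (ℕ → ℕ), S ∩ T ∩ {ω | ∀ k ≤ n, ω k = y k} = ∅ := by
        intro T
        refine Set.eq_empty_of_forall_notMem ?_
        rintro ω ⟨⟨h, -⟩, h'⟩
        exact hy (hdep ω y h' h)
      rw [h0, h0]
      simp
  · intro i hi
    have : S ∩ {ω | ω n = i} ∩ {ω | ∀ k ≤ n, ω k = y k} = ∅ := by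
      refine Set.eq_empty_of_forall_notMem ?_
      rintro ω ⟨⟨-, h⟩, h'⟩
      exact hi (h.symm.trans (h' n le_rfl))
    rw [this]
    simp

theorem IsLocalTimeChain.measure_zero_eq {m : ℝ} {μ : Measure (ℕ → ℕ)}
    (hμ : IsLocalTimeChain m μ) (i : ℕ) : μ {ω | ω 0 = i} = if i = 1 then 1 else 0 := by
  simpa using hμ 0 (fun _ => i)

/-- The negative binomial weights `i (1-θ)² θ^(i-1)`. -/
noncomputable def negBinomWeight (θ : ℝ) (i : ℕ) : ℝ := i * (1 - θ) ^ 2 * θ ^ (i - 1)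

theorem negBinomWeight_nonneg {θ : ℝ} (h : 0 ≤ θ) (i : ℕ) : 0 ≤ negBinomWeight θ i := by
  unfold negBinomWeight
  positivity

theorem ptrans_nonneg {m : ℝ} (hm : 1 < m) (i j : ℕ) : 0 ≤ ptrans m i j := by
  unfold ptrans
  positivity

theorem succ_mul_choose_comm (k l : ℕ) :
    (k + 1) * (k + l + 1).choose (k + 1) = (l + 1) * (k + l + 1).choose (l + 1) := by
  have h1 := Nat.add_one_mul_choose_eq (k + l) k
  have h2 := Nat.add_one_mul_choose_eq (k + l) l
  have h3 : (k + l).choose k = (k + l).choose l := Nat.choose_symm_add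
  rw [mul_comm, ← h1, h3, h2, mul_comm]

/-- The transition kernel maps negative binomial laws to negative binomial laws. -/
theorem hasSum_negBinomWeight_mul_ptrans {m θ : ℝ} (hm : 1 < m) (h0 : 0 ≤ θ) (h1 : θ < 1)
    (j : ℕ) :
    HasSum (fun i => negBinomWeight θ i * ptrans m i j)
      (negBinomWeight (1 / (m + 1 - m * θ)) j) := by
  have hd : 0 < m + 1 - m * θ := by nlinarith
  rw [← hasSum_nat_add_iff' 1]
  have hz : negBinomWeight θ 0 = 0 := by simp [negBinomWeight]
  simp only [Finset.range_one, Finset.sum_singleton, hz, zero_mul, sub_zero]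
  rcases j with _ | l
  · simp [negBinomWeight, ptrans]
  have hr : ‖θ * m / (m + 1)‖ < 1 := by
    rw [Real.norm_of_nonneg (by positivity), div_lt_one (by positivity)]
    nlinarith
  have key := (hasSum_choose_mul_geometric_of_norm_lt_one (l + 1) hr).mul_left
    ((l + 1) * (1 - θ) ^ 2 * m ^ 2 / (m + 1) ^ (l + 2))
  convert key using 2 with k
  · rfl
  · have hc : ((k : ℝ) + 1) * (k + l + 1).choose (k + 1)
        = (l + 1) * (k + l + 1).choose (l + 1) := by exact_mod_cast succ_mul_choose_comm k l
    have e1 : k + 1 + (l + 1) - 1 = k + l + 1 := by omega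
    have e2 : k + (l + 1) = k + l + 1 := by omega
    simp only [negBinomWeight, ptrans, e1, e2, Nat.add_sub_cancel]
    push_cast
    calc ((k : ℝ) + 1) * (1 - θ) ^ 2 * θ ^ k *
          ((k + l + 1).choose (k + 1) * m ^ (k + 1 + 1) / (m + 1) ^ (k + 1 + (l + 1)))
        = (((k : ℝ) + 1) * (k + l + 1).choose (k + 1)) * ((1 - θ) ^ 2 * θ ^ k *
          (m ^ (k + 1 + 1) / (m + 1) ^ (k + 1 + (l + 1)))) := by ring
      _ = _ := by
        rw [hc, div_pow, mul_pow]
        have : m + 1 ≠ 0 := by positivity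
        field_simp
        ring
  · have h2 : 1 - θ * m / (m + 1) = (m + 1 - m * θ) / (m + 1) := by
      field_simp
    have h3 : 1 - 1 / (m + 1 - m * θ) = m * (1 - θ) / (m + 1 - m * θ) := by
      field_simp
      ring
    simp only [negBinomWeight, h2, h3, Nat.add_sub_cancel]
    have : m + 1 ≠ 0 := by positivity
    push_cast
    simp only [div_pow, one_pow]
    field_simp
    ring

/-- The parameter of the negative binomial law of the chain at time `n`. -/
noncomputable def chainParam (m : ℝ) (n : ℕ) : ℝ := (m ^ n - 1) / (m ^ (n + 1) - 1)

theorem chainParam_nonneg {m : ℝ} (hm : 1 < m) (n : ℕ) : 0 ≤ chainParam m n :=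
  div_nonneg (sub_nonneg.2 (one_le_pow₀ hm.le)) (sub_nonneg.2 (one_le_pow₀ hm.le))

theorem chainParam_le {m : ℝ} (hm : 1 < m) (n : ℕ) : chainParam m n ≤ 1 / m := by
  have h : 1 < m ^ (n + 1) := one_lt_pow₀ hm (by omega)
  rw [chainParam, div_le_div_iff₀ (by linarith) (by linarith), pow_succ]
  nlinarith

theorem chainParam_lt_one {m : ℝ} (hm : 1 < m) (n : ℕ) : chainParam m n < 1 :=
  (chainParam_le hm n).trans_lt ((div_lt_one (by linarith)).2 hm)

theorem chainParam_succ {m : ℝ} (hm : 1 < m) (n : ℕ) :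
    chainParam m (n + 1) = 1 / (m + 1 - m * chainParam m n) := by
  have h : 0 < m ^ (n + 1) - 1 := sub_pos.2 (one_lt_pow₀ hm (by omega))
  have h' : 0 < m ^ (n + 1 + 1) - 1 := sub_pos.2 (one_lt_pow₀ hm (by omega))
  have e : m + 1 - m * chainParam m n = (m ^ (n + 1 + 1) - 1) / (m ^ (n + 1) - 1) := by
    rw [chainParam]
    field_simp
    ring
  rw [e, one_div_div, chainParam]

theorem tendsto_chainParam {m : ℝ} (hm : 1 < m) :
    Filter.Tendsto (chainParam m) Filter.atTop (nhds (1 / m)) := by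
  have h0 : Filter.Tendsto (fun n : ℕ => (m⁻¹) ^ n) Filter.atTop (nhds 0) :=
    tendsto_pow_atTop_nhds_zero_of_lt_one (by positivity) (inv_lt_one_of_one_lt₀ hm)
  have h1 : Filter.Tendsto (fun n : ℕ => (1 - (m⁻¹) ^ n) / (m - (m⁻¹) ^ n)) Filter.atTop
      (nhds ((1 - 0) / (m - 0))) :=
    (tendsto_const_nhds.sub h0).div (tendsto_const_nhds.sub h0) (by linarith)
  simp only [sub_zero] at h1
  refine h1.congr fun n => ?_
  have hp : 0 < m ^ n := by positivity
  have h : 0 < m ^ (n + 1) - 1 := sub_pos.2 (one_lt_pow₀ hm (by omega))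
  have e1 : 1 - (m⁻¹) ^ n = (m ^ n - 1) / m ^ n := by
    rw [inv_pow]
    field_simp
  have e2 : m - (m⁻¹) ^ n = (m ^ (n + 1) - 1) / m ^ n := by
    rw [inv_pow]
    field_simp
    ring
  rw [e1, e2, div_div_div_cancel_right₀ hp.ne', chainParam]

theorem IsLocalTimeChain.measure_coord_eq {m : ℝ} (hm : 1 < m) {μ : Measure (ℕ → ℕ)}
    (hμ : IsLocalTimeChain m μ) (n j : ℕ) :
    μ {ω | ω n = j} = ENNReal.ofReal (negBinomWeight (chainParam m n) j) := by
  induction n generalizing j with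
  | zero =>
    rw [hμ.measure_zero_eq]
    rcases j with _ | _ | j <;> simp [negBinomWeight, chainParam]
  | succ n ih =>
    have h := hμ.measure_inter_succ (n := n) MeasurableSet.univ (fun _ _ _ h => h) j
    simp only [Set.univ_inter] at h
    have hs := hasSum_negBinomWeight_mul_ptrans hm (chainParam_nonneg hm n)
      (chainParam_lt_one hm n) j
    have hn := negBinomWeight_nonneg (chainParam_nonneg hm n)
    rw [h, chainParam_succ hm, ← hs.tsum_eq, ENNReal.ofReal_tsum_of_nonneg
      (fun i => mul_nonneg (hn i) (ptrans_nonneg hm i j)) hs.summable]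
    exact tsum_congr fun i => by rw [ih, ENNReal.ofReal_mul (hn i)]

/-- Trajectories visiting `1` at time `k` and not at the times in `(k, k + l]`. -/
def lastVisit (k l : ℕ) : Set (ℕ → ℕ) := {ω | ω k = 1 ∧ ∀ i, k < i → i ≤ k + l → ω i ≠ 1}

theorem measurableSet_lastVisit (k l : ℕ) : MeasurableSet (lastVisit k l) := by
  have : lastVisit k l = {ω | ω k = 1} ∩ ⋂ i, ⋂ (_ : k < i), ⋂ (_ : i ≤ k + l),
      {ω : ℕ → ℕ | ω i = 1}ᶜ := by
    ext ω
    simp [lastVisit]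
  rw [this]
  exact (measurableSet_coord_eq k 1).inter (MeasurableSet.iInter fun i =>
    MeasurableSet.iInter fun _ => MeasurableSet.iInter fun _ => (measurableSet_coord_eq i 1).compl)

theorem IsLocalTimeChain.measure_lastVisit_succ_inter {m : ℝ} {μ : Measure (ℕ → ℕ)}
    (hμ : IsLocalTimeChain m μ) (k l j : ℕ) :
    μ (lastVisit k (l + 1) ∩ {ω | ω (k + (l + 1)) = j}) = if j = 1 then 0 else
      ∑' i, μ (lastVisit k l ∩ {ω | ω (k + l) = i}) * ENNReal.ofReal (ptrans m i j) := by
  split_ifs with hj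
  · have : lastVisit k (l + 1) ∩ {ω | ω (k + (l + 1)) = j} = ∅ := by
      refine Set.eq_empty_of_forall_notMem ?_
      rintro ω ⟨⟨-, h⟩, h'⟩
      exact h _ (by omega) le_rfl (h'.trans hj)
    rw [this, measure_empty]
  · rw [← hμ.measure_inter_succ (measurableSet_lastVisit k l) ?_ j]
    · congr 1
      ext ω
      simp only [lastVisit, Set.mem_inter_iff, Set.mem_ofPred_eq, ← add_assoc]
      constructor
      · rintro ⟨⟨h1, h2⟩, h3⟩
        exact ⟨⟨h1, fun i hi hi' => h2 i hi (by omega)⟩, h3⟩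
      · rintro ⟨⟨h1, h2⟩, h3⟩
        refine ⟨⟨h1, fun i hi hi' => ?_⟩, h3⟩
        rcases hi'.lt_or_eq with h | rfl
        · exact h2 i hi (by omega)
        · exact h3 ▸ hj
    · rintro ω ω' h ⟨h1, h2⟩
      exact ⟨h k (by omega) ▸ h1, fun i hi hi' => h i hi' ▸ h2 i hi hi'⟩

theorem IsLocalTimeChain.measure_lastVisit_inter {m : ℝ} {μ : Measure (ℕ → ℕ)}
    (hμ : IsLocalTimeChain m μ) (k l j : ℕ) :
    μ (lastVisit k l ∩ {ω | ω (k + l) = j}) =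
      μ {ω | ω k = 1} * μ (lastVisit 0 l ∩ {ω | ω (0 + l) = j}) := by
  induction l generalizing j with
  | zero =>
    have h : ∀ k, lastVisit k 0 ∩ {ω | ω (k + 0) = j} =
        if j = 1 then {ω | ω k = 1} else ∅ := by
      intro k
      ext ω
      split_ifs with hj
      · simp only [lastVisit, Set.mem_inter_iff, Set.mem_ofPred_eq, add_zero, hj]
        exact ⟨fun h => h.2, fun h => ⟨⟨h, fun i _ _ => by omega⟩, h⟩⟩
      · simp only [lastVisit, Set.mem_inter_iff, Set.mem_ofPred_eq, add_zero,
          Set.mem_empty_iff_false, iff_false]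
        rintro ⟨⟨h, -⟩, h'⟩
        exact hj (h'.symm.trans h)
    rw [h, h]
    split_ifs <;> simp [hμ.measure_zero_eq]
  | succ l ih =>
    rw [hμ.measure_lastVisit_succ_inter, hμ.measure_lastVisit_succ_inter]
    split_ifs
    · simp
    · rw [← ENNReal.tsum_mul_left]
      exact tsum_congr fun i => by rw [ih, mul_assoc]

theorem IsLocalTimeChain.measure_lastVisit {m : ℝ} {μ : Measure (ℕ → ℕ)}
    (hμ : IsLocalTimeChain m μ) (k l : ℕ) :
    μ (lastVisit k l) = μ {ω | ω k = 1} * μ (lastVisit 0 l) := by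
  rw [measure_eq_tsum_inter_fiber μ (measurable_pi_apply (k + l)) (measurableSet_lastVisit k l),
    measure_eq_tsum_inter_fiber μ (measurable_pi_apply (0 + l)) (measurableSet_lastVisit 0 l),
    ← ENNReal.tsum_mul_left]
  exact tsum_congr fun j => hμ.measure_lastVisit_inter k l j

/-- The renewal equation obtained by decomposing along the last visit to `1` before time `n`. -/
theorem IsLocalTimeChain.renewal {m : ℝ} {μ : Measure (ℕ → ℕ)}
    (hμ : IsLocalTimeChain m μ) (n : ℕ) [IsProbabilityMeasure μ] :
    ∑ l ∈ Finset.range (n + 1), μ {ω | ω (n - l) = 1} * μ (lastVisit 0 l) = 1 := by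
  simp_rw [← hμ.measure_lastVisit]
  rw [← measure_biUnion_finset]
  · refine le_antisymm prob_le_one ?_
    have h0 : μ {ω | ω 0 = 1} = 1 := by simp [hμ.measure_zero_eq]
    rw [← h0]
    refine measure_mono fun ω (hω : ω 0 = 1) => ?_
    have hle := Nat.findGreatest_le (P := fun k => ω k = 1) n
    have hsp := Nat.findGreatest_spec (P := fun k => ω k = 1) (Nat.zero_le n) hω
    simp only [Set.mem_iUnion, Finset.mem_range]
    refine ⟨n - Nat.findGreatest (fun k => ω k = 1) n, by omega, ?_, fun i hi hi' => ?_⟩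
    · rwa [Nat.sub_sub_self hle]
    · exact Nat.findGreatest_is_greatest (P := fun k => ω k = 1) (n := n)
        (by omega) (by omega)
  · intro a ha b hb hab
    simp only [Finset.coe_range, Set.mem_Iio] at ha hb
    refine Set.disjoint_left.2 ?_
    rintro ω ⟨h1, h2⟩ ⟨h3, h4⟩
    rcases Nat.lt_or_gt_of_ne hab with h | h
    · exact h4 (n - a) (by omega) (by omega) h1
    · exact h2 (n - b) (by omega) (by omega) h3
  · exact fun l _ => measurableSet_lastVisit _ _

/-- A renewal theorem: if `u` is bounded below by its positive limit `c`, the renewal equation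
`∑_{l ≤ n} u (n - l) r l = 1` forces `∑ r = 1 / c`. -/
theorem hasSum_of_renewal {u r : ℕ → ℝ} {c : ℝ} (hc : 0 < c) (hcu : ∀ n, c ≤ u n)
    (hu : ∀ n, u n ≤ 1) (hlim : Filter.Tendsto u Filter.atTop (nhds c)) (hr : ∀ n, 0 ≤ r n)
    (hren : ∀ n, ∑ l ∈ Finset.range (n + 1), u (n - l) * r l = 1) : HasSum r (1 / c) := by
  have hs : Summable r := by
    refine summable_of_sum_range_le (c := 1 / c) hr fun n => ?_
    rw [le_div_iff₀ hc, Finset.sum_mul, ← hren n]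
    calc ∑ l ∈ Finset.range n, r l * c ≤ ∑ l ∈ Finset.range n, u (n - l) * r l :=
          Finset.sum_le_sum fun l _ => by nlinarith [hcu (n - l), hr l]
      _ ≤ _ := by
        rw [Finset.sum_range_succ]
        nlinarith [hcu (n - n), hr n, mul_nonneg (hc.le.trans (hcu (n - n))) (hr n)]
  have ht : Filter.Tendsto
      (fun n => ∑' l, if l ∈ Finset.range (n + 1) then u (n - l) * r l else 0)
      Filter.atTop (nhds (∑' l, c * r l)) := by
    refine tendsto_tsum_of_dominated_convergence hs (fun l => ?_) (.of_forall fun n l => ?_)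
    · refine ((hlim.comp (Filter.tendsto_sub_atTop_nat l)).mul_const (r l)).congr' ?_
      filter_upwards [Filter.eventually_ge_atTop l] with n hn
      rw [if_pos (Finset.mem_range.2 (by omega))]
      rfl
    · have h0 := hc.le.trans (hcu (n - l))
      split_ifs
      · rw [Real.norm_of_nonneg (mul_nonneg h0 (hr l))]
        exact mul_le_of_le_one_left (hr l) (hu _)
      · simpa using hr l
  have h1 : ∀ n, (∑' l, if l ∈ Finset.range (n + 1) then u (n - l) * r l else 0) = 1 := by
    intro n
    rw [← hren n, tsum_eq_sum (s := Finset.range (n + 1)) (fun l hl => if_neg hl)]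
    exact Finset.sum_congr rfl fun l hl => if_pos hl
  simp_rw [h1, tsum_mul_left] at ht
  have h2 : c * ∑' l, r l = 1 := tendsto_nhds_unique ht tendsto_const_nhds
  rw [hs.hasSum_iff, eq_div_iff hc.ne', mul_comm, h2]

/-- The return time as the number of times `n` before the return. -/
theorem returnTime_eq_tsum (ω : ℕ → ℕ) (h0 : ω 0 = 1) :
    (if ∃ n : ℕ, 1 ≤ n ∧ ω n = 1 then (retTime ω : ℝ≥0∞) else ∞) =
      ∑' n, (lastVisit 0 n).indicator 1 ω := by
  split_ifs with h
  · have hmem : 1 ≤ retTime ω ∧ ω (retTime ω) = 1 := Nat.sInf_mem h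
    have hiff : ∀ n, ω ∈ lastVisit 0 n ↔ n < retTime ω := by
      intro n
      constructor
      · rintro ⟨-, hn⟩
        by_contra! hle
        exact hn _ hmem.1 (by omega) hmem.2
      · intro hn
        exact ⟨h0, fun i hi hi' h1 =>
          absurd (Nat.sInf_le (show i ∈ {n | 1 ≤ n ∧ ω n = 1} from ⟨hi, h1⟩))
            (by change ¬ retTime ω ≤ i; omega)⟩
    rw [tsum_eq_sum (s := Finset.range (retTime ω)) fun n hn =>
        Set.indicator_of_notMem (by simpa [hiff] using hn) _,
      Finset.sum_congr rfl fun n hn =>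
        Set.indicator_of_mem ((hiff n).2 (Finset.mem_range.1 hn)) _]
    simp
  · push Not at h
    have hmem : ∀ n, ω ∈ lastVisit 0 n := fun n => ⟨h0, fun i hi _ => h i hi⟩
    simp [Set.indicator_of_mem (hmem _)]

/-- For the local-time Markov chain started at `1`, the expected first
return time to state `1` equals the reciprocal of the stationary mass at `1`:
`E[γ] = m²/(m-1)²` (trajectories that never return contribute `∞`). -/
theorem return_time_expectation (m : ℝ) (hm : 1 < m)
    (μ : Measure (ℕ → ℕ)) [IsProbabilityMeasure μ] (hμ : IsLocalTimeChain m μ) :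
    ∫⁻ ω, (if ∃ n : ℕ, 1 ≤ n ∧ ω n = 1 then (retTime ω : ℝ≥0∞) else ∞) ∂μ =
      ENNReal.ofReal (m ^ 2 / (m - 1) ^ 2) := by
  have hstart : ∀ᵐ ω ∂μ, ω 0 = 1 := by
    refine (mem_ae_iff_prob_eq_one (measurableSet_coord_eq 0 1)).2 ?_
    simp [hμ.measure_zero_eq]
  rw [lintegral_congr_ae (hstart.mono fun ω h0 => returnTime_eq_tsum ω h0),
    lintegral_tsum fun n => (measurable_one.indicator (measurableSet_lastVisit 0 n)).aemeasurable]
  simp_rw [lintegral_indicator_one (measurableSet_lastVisit 0 _)]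
  have hu : ∀ n, (μ {ω | ω n = 1}).toReal = (1 - chainParam m n) ^ 2 := fun n => by
    rw [hμ.measure_coord_eq hm, ENNReal.toReal_ofReal
      (negBinomWeight_nonneg (chainParam_nonneg hm n) 1)]
    simp [negBinomWeight]
  have hm1 : 1 / m < 1 := (div_lt_one (by linarith)).2 hm
  have hsum : HasSum (fun n => (μ (lastVisit 0 n)).toReal) (1 / (1 - 1 / m) ^ 2) := by
    refine hasSum_of_renewal (u := fun n => (μ {ω | ω n = 1}).toReal)
      (pow_pos (sub_pos.2 hm1) 2) (fun n => ?_) (fun n => ?_) ?_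
      (fun n => ENNReal.toReal_nonneg) (fun n => ?_)
    · rw [hu]
      exact pow_le_pow_left₀ (sub_pos.2 hm1).le (by linarith [chainParam_le hm n]) 2
    · exact ENNReal.toReal_le_of_le_ofReal zero_le_one (by simpa using prob_le_one)
    · simp_rw [hu]
      exact (tendsto_const_nhds.sub (tendsto_chainParam hm)).pow 2
    · simp_rw [← ENNReal.toReal_mul]
      rw [← ENNReal.toReal_sum fun l _ =>
        ENNReal.mul_ne_top (measure_ne_top _ _) (measure_ne_top _ _), hμ.renewal n]
      rfl
  have hval : 1 / (1 - 1 / m) ^ 2 = m ^ 2 / (m - 1) ^ 2 := by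
    have h1 : m ≠ 0 := by linarith
    have h2 : 1 - 1 / m = (m - 1) / m := by field_simp
    rw [h2, div_pow, one_div_div]
  rw [← hval, ← hsum.tsum_eq, ENNReal.ofReal_tsum_of_nonneg (fun _ => ENNReal.toReal_nonneg)
    hsum.summable]
  exact tsum_congr fun n => (ENNReal.ofReal_toReal (measure_ne_top _ _)).symm
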